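/- arXiv:1905.06084 — 6 statements merged into one kernel-verified Lean document; each statement's English description precedes it below -/
import Mathlib

section
/- Let G be a bipartite graph with vertex classes P (players) and F (resources), let M be a maximum matching of G, let S be a set of players not matched by M, let T be a set of players, and let p be a player. If f_M(S, T ∪ {p}) = f_M(S, T) + 1, then for every subset T' ⊆ T one has f_M(S, T' ∪ {p}) = f_M(S, T') + 1. -/
section Framework

variable {P F : Type*} [Fintype P] [Fintype F] [DecidableEq P] [DecidableEq F]

/-- A matching of the bipartite graph with edge relation `E`: a set of
player–resource pairs that are edges, no two sharing a player or a resource. -/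
def IsMatching (E : P → F → Prop) (M : Finset (P × F)) : Prop :=
  (∀ e ∈ M, E e.1 e.2) ∧
  (∀ e ∈ M, ∀ e' ∈ M, e.1 = e'.1 → e = e') ∧
  (∀ e ∈ M, ∀ e' ∈ M, e.2 = e'.2 → e = e')

/-- A maximum matching of the bipartite graph with edge relation `E`. -/
def IsMaxMatching (E : P → F → Prop) (M : Finset (P × F)) : Prop :=
  IsMatching E M ∧ ∀ M' : Finset (P × F), IsMatching E M' → M'.card ≤ M.card

/-- The directed graph `G_M`: each edge `{p, r}` of `G` is oriented from the
resource `r` to the player `p` if `{p, r} ∈ M`, and from `p` to `r` otherwise. -/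
def DirAdj (E : P → F → Prop) (M : Finset (P × F)) : P ⊕ F → P ⊕ F → Prop :=
  fun x y => match x, y with
  | Sum.inl p, Sum.inr r => E p r ∧ (p, r) ∉ M
  | Sum.inr r, Sum.inl p => (p, r) ∈ M
  | _, _ => False

/-- A (simple) directed path in the digraph with adjacency `A`, recorded as
its nonempty, duplicate-free list of vertices.  A one-vertex list is a
trivial path. -/
def IsDirPath (A : P ⊕ F → P ⊕ F → Prop) (l : List (P ⊕ F)) : Prop :=
  l ≠ [] ∧ l.Chain' A ∧ l.Nodup

/-- The path `l` starts at a player belonging to `S`. -/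
def startsIn (S : Set P) (l : List (P ⊕ F)) : Prop :=
  ∃ p ∈ S, l.head? = some (Sum.inl p)

/-- The path `l` ends at a player belonging to `T`. -/
def endsIn (T : Set P) (l : List (P ⊕ F)) : Prop :=
  ∃ q ∈ T, l.getLast? = some (Sum.inl q)

/-- A feasible solution for `G_M(S,T)`: a set of pairwise vertex-disjoint
directed paths in `G_M`, each starting at a vertex of `S` and ending at a
vertex of `T` (single-vertex paths at vertices of `S ∩ T` are allowed). -/
def Feasible (E : P → F → Prop) (M : Finset (P × F)) (S T : Set P)
    (Ps : Finset (List (P ⊕ F))) : Prop :=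
  (∀ l ∈ Ps, IsDirPath (DirAdj E M) l) ∧
  (∀ l ∈ Ps, startsIn S l) ∧
  (∀ l ∈ Ps, endsIn T l) ∧
  (∀ l ∈ Ps, ∀ l' ∈ Ps, l ≠ l' → ∀ x, x ∈ l → x ∉ l')

/-- `f_M(S,T)`: the maximum number of pairwise vertex-disjoint paths in `G_M`
from `S` to `T`. -/
noncomputable def fM (E : P → F → Prop) (M : Finset (P × F)) (S T : Set P) : ℕ :=
  sSup {n | ∃ Ps : Finset (List (P ⊕ F)), Feasible E M S T Ps ∧ Ps.card = n}

/-- The sources of a set of paths. -/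
def srcOf (Ps : Finset (List (P ⊕ F))) : Set P :=
  {p | ∃ l ∈ Ps, l.head? = some (Sum.inl p)}

/-- The sinks of a set of paths. -/
def sinkOf (Ps : Finset (List (P ⊕ F))) : Set P :=
  {p | ∃ l ∈ Ps, l.getLast? = some (Sum.inl p)}

/-- The path `l` traverses the (undirected) edge `{p, r}`. -/
def usesEdge (l : List (P ⊕ F)) (p : P) (r : F) : Prop :=
  (Sum.inl p, Sum.inr r) ∈ l.zip l.tail ∨ (Sum.inr r, Sum.inl p) ∈ l.zip l.tail

open Classical in
/-- `M ⊕ Ps`: the symmetric difference of the matching `M` with the set of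
(undirected) edges used by the paths of `Ps`. -/
noncomputable def symmDiffMatch (M : Finset (P × F)) (Ps : Finset (List (P ⊕ F))) :
    Finset (P × F) :=
  Finset.univ.filter (fun e : P × F => (∃ l ∈ Ps, usesEdge l e.1 e.2) ↔ e ∉ M)

end Framework

/-- A back-tracing of the digraph `A` away from `S`: an injection on the complement of `S` which
moves each vertex nowhere or to an in-neighbour, and whose range avoids `B`.  Such maps exist
precisely when `B` is linked from `S` by disjoint paths. -/
def IsBacktrace {V : Type*} (A : V → V → Prop) (S B : Set V) (g : V → V) : Prop :=
  Set.InjOn g Sᶜ ∧ (∀ v ∉ S, g v = v ∨ A (g v) v) ∧ ∀ v ∉ S, g v ∉ B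

/-- The augmentation step: two back-tracings are recombined along an alternating path. -/
theorem IsBacktrace.exchange {V : Type*} {A : V → V → Prop} {S B C : Set V} {p : V} {g g' : V → V}
    (hg : IsBacktrace A S (insert p B) g) (hg' : IsBacktrace A S C g') (hp : p ∉ B) :
    (∃ h, IsBacktrace A S (insert p C) h) ∨
      ∃ y ∈ C, y ∉ B ∧ ∃ h, IsBacktrace A S (insert y B) h := by
  classical
  obtain ⟨inj, val, avoid⟩ := hg
  obtain ⟨inj', val', avoid'⟩ := hg'
  by_cases hpr : ∃ u ∉ S, g' u = p
  swap
  · left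
    refine ⟨g', inj', val', fun v hv hmem => ?_⟩
    rcases hmem with h | h
    · exact hpr ⟨v, hv, h⟩
    · exact avoid' v hv h
  obtain ⟨u₁, hu₁, hu₁p⟩ := hpr
  let K : V → Prop := Relation.ReflTransGen (fun u w => w ∉ S ∧ g' w = g u) u₁
  have K_next : ∀ u w, K u → w ∉ S → g' w = g u → K w := fun u w hu hw h => hu.tail ⟨hw, h⟩
  have K_prev : ∀ u, K u → u ∉ S ∧ (u = u₁ ∨ ∃ w, K w ∧ w ∉ S ∧ g' u = g w) := by
    intro u hu
    induction hu with
    | refl => exact ⟨hu₁, Or.inl rfl⟩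
    | tail hb hc ih => exact ⟨hc.1, Or.inr ⟨_, hb, ih.1, hc.2⟩⟩
  have cross : ∀ u v, K u → ¬ K v → v ∉ S → g' u ≠ g v := by
    intro u v hu hv hvS e
    rcases (K_prev u hu).2 with rfl | ⟨w, hw, hwS, hwe⟩
    · exact avoid v hvS (Or.inl (e.symm.trans hu₁p))
    · exact hv (inj hwS hvS (hwe.symm.trans e) ▸ hw)
  by_cases hC : ∃ u, K u ∧ g u ∈ C
  · obtain ⟨u, hu, huC⟩ := hC
    have huS := (K_prev u hu).1
    refine Or.inr ⟨g u, huC, fun h => avoid u huS (Or.inr h),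
      fun v => if K v then g' v else g v, ?_, ?_, ?_⟩
    · intro a ha b hb hab
      by_cases hKa : K a <;> by_cases hKb : K b <;> simp only [hKa, hKb, if_true, if_false] at hab
      · exact inj' ha hb hab
      · exact (cross a b hKa hKb hb hab).elim
      · exact (cross b a hKb hKa ha hab.symm).elim
      · exact inj ha hb hab
    · intro v hv
      by_cases hK : K v
      · simpa [hK] using val' v hv
      · simpa [hK] using val v hv
    · intro v hv
      by_cases hK : K v <;> simp only [hK, if_true, if_false]
      · rintro (h | h)
        · exact avoid' v hv (h ▸ huC)
        · rcases (K_prev v hK).2 with rfl | ⟨w, -, hwS, hwe⟩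
          · exact hp (hu₁p ▸ h)
          · exact avoid w hwS (Or.inr (hwe ▸ h))
      · rintro (h | h)
        · exact hK (inj hv huS h ▸ hu)
        · exact avoid v hv (Or.inr h)
  · refine Or.inl ⟨fun v => if K v then g v else g' v, ?_, ?_, ?_⟩
    · intro a ha b hb hab
      by_cases hKa : K a <;> by_cases hKb : K b <;> simp only [hKa, hKb, if_true, if_false] at hab
      · exact inj ha hb hab
      · exact (hKb (K_next a b hKa hb hab.symm)).elim
      · exact (hKa (K_next b a hKb ha hab)).elim
      · exact inj' ha hb hab
    · intro v hv
      by_cases hK : K v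
      · simpa [hK] using val v hv
      · simpa [hK] using val' v hv
    · intro v hv
      by_cases hK : K v <;> simp only [hK, if_true, if_false]
      · rintro (h | h)
        · exact avoid v hv (Or.inl h)
        · exact hC ⟨v, hK, h⟩
      · rintro (h | h)
        · exact hK (inj' hu₁ hv (hu₁p.trans h.symm) ▸ Relation.ReflTransGen.refl)
        · exact avoid' v hv h

/-- Backward orbits of a back-tracing from the avoided set never meet before reaching `S`. -/
theorem IsBacktrace.iterate_eq {V : Type*} {A : V → V → Prop} {S B : Set V} {g : V → V}
    (hg : IsBacktrace A S B g) {t t' : V} (ht : t ∈ B) (ht' : t' ∈ B) (i j : ℕ)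
    (hi : ∀ k < i, g^[k] t ∉ S) (hj : ∀ k < j, g^[k] t' ∉ S) (h : g^[i] t = g^[j] t') :
    i = j ∧ t = t' := by
  induction i generalizing j with
  | zero =>
    cases j with
    | zero => exact ⟨rfl, h⟩
    | succ j =>
      rw [Function.iterate_succ_apply'] at h
      exact (hg.2.2 _ (hj j (by omega)) (h ▸ ht)).elim
  | succ i ih =>
    cases j with
    | zero =>
      rw [Function.iterate_succ_apply'] at h
      exact (hg.2.2 _ (hi i (by omega)) (h.symm ▸ ht')).elim
    | succ j =>
      rw [Function.iterate_succ_apply', Function.iterate_succ_apply'] at h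
      have := ih j (fun k hk => hi k (by omega)) (fun k hk => hj k (by omega))
        (hg.1 (hi i (by omega)) (hj j (by omega)) h)
      exact ⟨by omega, this.2⟩

theorem IsBacktrace.exists_iterate_mem {V : Type*} [Finite V] {A : V → V → Prop} {S B : Set V}
    {g : V → V} (hg : IsBacktrace A S B g) {t : V} (ht : t ∈ B) : ∃ n, g^[n] t ∈ S := by
  by_contra! hn
  exact not_injective_infinite_finite (fun i : ℕ => g^[i] t) fun i j h =>
    (hg.iterate_eq ht ht i j (fun k _ => hn k) (fun k _ => hn k) h).1

section Linkage

variable {P F : Type*} {E : P → F → Prop} {M : Finset (P × F)} {S T : Set P}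

/-- A feasible solution yields as many avoidable players as it has paths. -/
theorem Feasible.exists_isBacktrace [Fintype P] [Fintype F] [DecidableEq P] [DecidableEq F]
    {Ps : Finset (List (P ⊕ F))} (h : Feasible E M S T Ps) :
    ∃ B : Finset P, ↑B ⊆ T ∧ B.card = Ps.card ∧
      ∃ g, IsBacktrace (DirAdj E M) (Sum.inl '' S) (Sum.inl '' (B : Set P)) g := by
  classical
  obtain ⟨hpath, hstart, hend, hdisj⟩ := h
  rcases Ps.eq_empty_or_nonempty with rfl | ⟨l₀, hl₀⟩
  · exact ⟨∅, by simp, rfl, id, Set.injOn_id _, fun _ _ => Or.inl rfl, by simp⟩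
  have : Nonempty P := ⟨(hstart l₀ hl₀).choose⟩
  choose! q hqT hq using hend
  have same : ∀ l ∈ Ps, ∀ l' ∈ Ps, ∀ x, x ∈ l → x ∈ l' → l = l' := by
    intro l hl l' hl' x hx hx'
    by_contra hne
    exact hdisj l hl l' hl' hne x hx hx'
  have same_idx : ∀ l ∈ Ps, ∀ l' ∈ Ps, ∀ (x : P ⊕ F) (i j : ℕ), l[i]? = some x → l'[j]? = some x →
      l = l' ∧ i = j := by
    intro l hl l' hl' x i j hi hj
    obtain rfl := same l hl l' hl' x (List.mem_of_getElem? hi) (List.mem_of_getElem? hj)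
    refine ⟨rfl, ?_⟩
    obtain ⟨hi', -⟩ := List.getElem?_eq_some_iff.1 hi
    exact (List.getElem?_inj hi' (hpath l hl).2.2).1 (hi.trans hj.symm)
  let R : P ⊕ F → P ⊕ F → Prop := fun a v => ∃ l ∈ Ps, ∃ i : ℕ, l[i]? = some a ∧ l[i + 1]? = some v
  have head_of_no_pred : ∀ l ∈ Ps, ∀ v ∈ l, (¬ ∃ a, R a v) → v ∈ Sum.inl '' S := by
    intro l hl v hv hno
    obtain ⟨i, hi⟩ := List.mem_iff_getElem?.1 hv
    cases i with
    | zero =>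
      obtain ⟨s, hs, hs'⟩ := hstart l hl
      rw [List.head?_eq_getElem?, hi] at hs'
      exact ⟨s, hs, (Option.some.inj hs').symm⟩
    | succ i =>
      obtain ⟨hlt, -⟩ := List.getElem?_eq_some_iff.1 hi
      exact (hno ⟨l[i], l, hl, i, List.getElem?_eq_getElem (by omega), hi⟩).elim
  let g : P ⊕ F → P ⊕ F := fun v => if hv : ∃ a, R a v then hv.choose else v
  have g_spec : ∀ v, (R (g v) v) ∨ (g v = v ∧ ¬ ∃ a, R a v) := by
    intro v
    by_cases hv : ∃ a, R a v
    · left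
      simp only [g, dif_pos hv]
      exact hv.choose_spec
    · right
      exact ⟨by simp only [g, dif_neg hv], hv⟩
  refine ⟨Ps.image q, ?_, Finset.card_image_of_injOn ?_, g, ?_, ?_, ?_⟩
  · intro x hx
    obtain ⟨l, hl, rfl⟩ := Finset.mem_image.1 (Finset.mem_coe.1 hx)
    exact hqT l hl
  · intro l hl l' hl' e
    refine same l hl l' hl' _ (List.mem_of_getLast? (hq l hl)) ?_
    rw [e]
    exact List.mem_of_getLast? (hq l' hl')
  · intro u hu v hv huv
    rcases g_spec u with ⟨l, hl, i, hi, hi'⟩ | ⟨hu1, hu2⟩ <;>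
      rcases g_spec v with ⟨l', hl', j, hj, hj'⟩ | ⟨hv1, hv2⟩
    · rw [← huv] at hj
      obtain ⟨rfl, rfl⟩ := same_idx l hl l' hl' _ _ _ hi hj
      exact Option.some.inj (hi'.symm.trans hj')
    · rw [huv, hv1] at hi
      exact (hv (head_of_no_pred l hl v (List.mem_of_getElem? hi) hv2)).elim
    · rw [← huv, hu1] at hj
      exact (hu (head_of_no_pred l' hl' u (List.mem_of_getElem? hj) hu2)).elim
    · exact hu1.symm.trans (huv.trans hv1)
  · intro v hv
    rcases g_spec v with ⟨l, hl, i, hi, hi'⟩ | ⟨h1, -⟩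
    · right
      obtain ⟨hlt, e⟩ := List.getElem?_eq_some_iff.1 hi
      obtain ⟨hlt', e'⟩ := List.getElem?_eq_some_iff.1 hi'
      rw [← e]
      conv_rhs => rw [← e']
      exact List.isChain_iff_getElem.1 (hpath l hl).2.1 i hlt'
    · exact Or.inl h1
  · rintro v hv ⟨t, ht, hgt⟩
    obtain ⟨l, hl, rfl⟩ := Finset.mem_image.1 (Finset.mem_coe.1 ht)
    have hlast := hq l hl
    rcases g_spec v with ⟨l', hl', i, hi, hi'⟩ | ⟨h1, h2⟩
    · rw [List.getLast?_eq_getElem?, hgt] at hlast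
      obtain ⟨rfl, e⟩ := same_idx l hl l' hl' _ _ _ hlast hi
      obtain ⟨hlt, -⟩ := List.getElem?_eq_some_iff.1 hi'
      omega
    · rw [hgt, h1] at hlast
      exact hv (head_of_no_pred l hl v (List.mem_of_getLast? hlast) h2)

/-- The backward orbits of a back-tracing form a feasible solution. -/
theorem IsBacktrace.exists_feasible [Fintype P] [Fintype F] [DecidableEq P] [DecidableEq F]
    {B : Finset P} (hBT : ↑B ⊆ T) {g : P ⊕ F → P ⊕ F}
    (hg : IsBacktrace (DirAdj E M) (Sum.inl '' S) (Sum.inl '' (B : Set P)) g) :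
    ∃ Ps : Finset (List (P ⊕ F)), Feasible E M S T Ps ∧ Ps.card = B.card := by
  classical
  have hB : ∀ t ∈ B, (Sum.inl t : P ⊕ F) ∈ Sum.inl '' (B : Set P) := fun t ht => ⟨t, ht, rfl⟩
  have hex : ∀ t ∈ B, ∃ n, g^[n] (Sum.inl t) ∈ Sum.inl '' S ∧
      ∀ k < n, g^[k] (Sum.inl t) ∉ Sum.inl '' S := by
    intro t ht
    have := hg.exists_iterate_mem (hB t ht)
    exact ⟨Nat.find this, Nat.find_spec this, fun k hk => Nat.find_min this hk⟩
  choose! n hn hmin using hex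
  let path : P → List (P ⊕ F) := fun t =>
    ((List.range (n t + 1)).map fun i => g^[i] (Sum.inl t)).reverse
  have hlast : ∀ t, (path t).getLast? = some (Sum.inl t) := by
    intro t
    simp [path]
  have mem_path : ∀ t x, x ∈ path t ↔ ∃ i ≤ n t, g^[i] (Sum.inl t) = x := by
    intro t x
    simp only [path, List.mem_reverse, List.mem_map, List.mem_range, Nat.lt_succ_iff]
  have key : ∀ t ∈ B, ∀ t' ∈ B, ∀ i ≤ n t, ∀ j ≤ n t', g^[i] (Sum.inl t) = g^[j] (Sum.inl t') →
      i = j ∧ (Sum.inl t : P ⊕ F) = Sum.inl t' := fun t ht t' ht' i hi j hj e =>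
    hg.iterate_eq (hB t ht) (hB t' ht') i j (fun k hk => hmin t ht k (by omega))
      (fun k hk => hmin t' ht' k (by omega)) e
  refine ⟨B.image path, ⟨?_, ?_, ?_, ?_⟩, Finset.card_image_of_injOn ?_⟩
  · simp only [Finset.forall_mem_image]
    intro t ht
    refine ⟨by simp [path], ?_, ?_⟩
    · refine List.isChain_reverse.2 (List.isChain_iff_getElem.2 fun i hi => ?_)
      simp only [List.length_map, List.length_range] at hi
      simp only [List.getElem_map, List.getElem_range]
      have hval := hg.2.1 _ (hmin t ht i (by omega))
      rw [← Function.iterate_succ_apply' g] at hval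
      refine hval.resolve_left fun e => ?_
      have := (key t ht t ht _ (by omega) _ (by omega) e).1
      omega
    · refine List.nodup_reverse.2 (List.Nodup.map_on ?_ List.nodup_range)
      intro i hi j hj e
      rw [List.mem_range] at hi hj
      exact (key t ht t ht i (by omega) j (by omega) e).1
  · simp only [Finset.forall_mem_image]
    intro t ht
    obtain ⟨s, hs, e⟩ := hn t ht
    refine ⟨s, hs, ?_⟩
    simp [path, List.range_succ, e]
  · simp only [Finset.forall_mem_image]
    exact fun t ht => ⟨t, hBT ht, hlast t⟩
  · simp only [Finset.forall_mem_image]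
    intro t ht t' ht' hne x hx hx'
    obtain ⟨i, hi, e⟩ := (mem_path t x).1 hx
    obtain ⟨j, hj, e'⟩ := (mem_path t' x).1 hx'
    exact hne (congrArg path (Sum.inl_injective (key t ht t' ht' i hi j hj (e.trans e'.symm)).2))
  · intro t _ t' _ e
    have := hlast t
    rw [e, hlast t'] at this
    exact (Sum.inl_injective (Option.some.inj this)).symm

variable [Fintype P] [Fintype F] [DecidableEq P] [DecidableEq F]

theorem bddAbove_card_feasible (E : P → F → Prop) (M : Finset (P × F)) (S T : Set P) :
    BddAbove {n | ∃ Ps : Finset (List (P ⊕ F)), Feasible E M S T Ps ∧ Ps.card = n} := by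
  refine ⟨Fintype.card P, ?_⟩
  rintro _ ⟨Ps, h, rfl⟩
  obtain ⟨B, -, hB, -⟩ := h.exists_isBacktrace
  exact hB ▸ Finset.card_le_univ B

/-- `f_M(S,T)` is the largest size of a set of players of `T` avoided by a back-tracing. -/
theorem exists_isBacktrace_card_eq_fM (E : P → F → Prop) (M : Finset (P × F)) (S T : Set P) :
    ∃ B : Finset P, ↑B ⊆ T ∧ B.card = fM E M S T ∧
      ∃ g, IsBacktrace (DirAdj E M) (Sum.inl '' S) (Sum.inl '' (B : Set P)) g := by
  obtain ⟨Ps, h, hc⟩ := Nat.sSup_mem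
    (s := {n | ∃ Ps : Finset (List (P ⊕ F)), Feasible E M S T Ps ∧ Ps.card = n})
    ⟨0, ∅, by simp [Feasible], rfl⟩ (bddAbove_card_feasible E M S T)
  obtain ⟨B, hBT, hB, hg⟩ := h.exists_isBacktrace
  exact ⟨B, hBT, hB.trans hc, hg⟩

theorem IsBacktrace.card_le_fM {B : Finset P} (hBT : ↑B ⊆ T) {g : P ⊕ F → P ⊕ F}
    (hg : IsBacktrace (DirAdj E M) (Sum.inl '' S) (Sum.inl '' (B : Set P)) g) :
    B.card ≤ fM E M S T := by
  obtain ⟨Ps, h, hc⟩ := hg.exists_feasible hBT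
  exact le_csSup (bddAbove_card_feasible E M S T) ⟨Ps, h, hc⟩

theorem fM_union_singleton_le (E : P → F → Prop) (M : Finset (P × F)) (S T : Set P) (p : P) :
    fM E M S (T ∪ {p}) ≤ fM E M S T + 1 := by
  obtain ⟨B, hBT, hB, g, hg⟩ := exists_isBacktrace_card_eq_fM E M S (T ∪ {p})
  have hle : (B.erase p).card ≤ fM E M S T := by
    refine IsBacktrace.card_le_fM (g := g) ?_ ⟨hg.1, hg.2.1, fun v hv hmem => hg.2.2 v hv ?_⟩
    · intro x hx
      obtain ⟨hxp, hxB⟩ := Finset.mem_erase.1 (Finset.mem_coe.1 hx)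
      exact (hBT hxB).resolve_right hxp
    · exact Set.image_mono (Finset.coe_subset.2 (Finset.erase_subset p B)) hmem
  have := Finset.pred_card_le_card_erase (s := B) (a := p)
  omega

end Linkage

/-- **Submodularity-type lemma.**  Let `M` be a maximum matching, `S` a set of
players unmatched by `M`, `T` a set of players and `p` a player.  If adding
`p` to `T` increases `f_M(S, ·)` by one, then adding `p` to any subset `T'`
of `T` also increases `f_M(S, ·)` by one. -/
theorem fM_add_player_mono
    {P F : Type*} [Fintype P] [Fintype F] [DecidableEq P] [DecidableEq F]
    (E : P → F → Prop) (M : Finset (P × F)) (hM : IsMaxMatching E M)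
    (S T : Set P) (hS : ∀ p ∈ S, ∀ r, (p, r) ∉ M) (p : P)
    (h : fM E M S (T ∪ {p}) = fM E M S T + 1) :
    ∀ T' ⊆ T, fM E M S (T' ∪ {p}) = fM E M S T' + 1 := by
  intro T' hT'
  refine le_antisymm (fM_union_singleton_le E M S T' p) ?_
  obtain ⟨B, hBT, hB, g, hg⟩ := exists_isBacktrace_card_eq_fM E M S (T ∪ {p})
  obtain ⟨C, hCT, hC, g', hg'⟩ := exists_isBacktrace_card_eq_fM E M S T'
  have hpB : p ∈ B := by
    by_contra hp
    have hBT' : ↑B ⊆ T := fun x hx => (hBT hx).resolve_right fun e => hp (e ▸ hx)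
    have := hg.card_le_fM hBT'
    omega
  have hpT : p ∉ T := by
    intro hp
    rw [Set.union_eq_self_of_subset_right (Set.singleton_subset_iff.2 hp)] at h
    omega
  have hinsert : ∀ (x : P) (D : Finset P), (insert (Sum.inl x) (Sum.inl '' (D : Set P)) :
      Set (P ⊕ F)) = Sum.inl '' ((insert x D : Finset P) : Set P) := by
    intro x D
    rw [Finset.coe_insert, Set.image_insert_eq]
  have hcard := Finset.card_erase_add_one hpB
  rw [← Finset.insert_erase hpB, ← hinsert] at hg
  rcases hg.exchange hg' (by simp) with ⟨k, hk⟩ | ⟨_, ⟨y, hy, rfl⟩, hyB, k, hk⟩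
  · rw [hinsert] at hk
    have hle := hk.card_le_fM (T := T' ∪ {p}) (by
      rw [Finset.coe_insert, Set.insert_eq, Set.union_comm]
      exact Set.union_subset_union_left _ hCT)
    rwa [Finset.card_insert_of_notMem fun hp => hpT (hT' (hCT hp)), hC] at hle
  · rw [hinsert] at hk
    have hle := hk.card_le_fM (T := T) (by
      rw [Finset.coe_insert, Set.insert_subset_iff]
      refine ⟨hT' (hCT hy), fun x hx => ?_⟩
      obtain ⟨hxp, hxB⟩ := Finset.mem_erase.1 (Finset.mem_coe.1 hx)
      exact (hBT hxB).resolve_right hxp)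
    rw [Finset.card_insert_of_notMem fun hy' => hyB ⟨y, hy', rfl⟩] at hle
    omega
end

section
/- Let λ = 26/99 and let z* be defined by z*(v) = 3λv/(2λ+v) for 0 < v < λ/2, z*(v) = 3λv/(3λ−v) for λ/2 ≤ v < 3λ/4, and z*(v) = λ for 3λ/4 ≤ v < λ. Let D be a finite set of resources with values v_r satisfying 0 < v_r < λ for all r ∈ D, suppose D is λ-minimal, and let r_0 ∈ D be a resource of least value in D. Then Σ_{r∈D} z*(v_r) ≤ 3λ/2 + z*(v_{r_0})/2. -/
/-- The dual value `z*` of a thin resource of value `v`, for `λ = 26/99`: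
`z*(v) = 3λv/(2λ+v)` if `0 < v < λ/2`, `z*(v) = 3λv/(3λ−v)` if
`λ/2 ≤ v < 3λ/4`, and `z*(v) = λ` if `3λ/4 ≤ v < λ`. -/
noncomputable def zstar (lam v : ℝ) : ℝ :=
  if v < lam / 2 then 3 * lam * v / (2 * lam + v)
  else if v < 3 * lam / 4 then 3 * lam * v / (3 * lam - v)
  else lam

/-- A finite set `D` of resources is `λ`-minimal if its total value is at
least `λ` while every proper subset has total value less than `λ`. -/
def LamMinimal {R : Type*} [DecidableEq R] (v : R → ℝ) (lam : ℝ) (D : Finset R) : Prop :=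
  lam ≤ ∑ r ∈ D, v r ∧ ∀ D' ⊂ D, ∑ r ∈ D', v r < lam

/-- Every value of `zstar` at a number in `(0, λ)` is at most `λ`. -/
theorem zstar_le {lam x : ℝ} (hx : 0 < x) (hxl : x < lam) : zstar lam x ≤ lam := by
  unfold zstar
  split_ifs with h1 h2
  · rw [div_le_iff₀ (by linarith)]
    nlinarith
  · rw [div_le_iff₀ (by linarith)]
    nlinarith
  · exact le_rfl

/-- The tangent line at `c` bounds the concave branch of `zstar` from above. -/
theorem concave_branch_le_tangent {lam x c : ℝ} (hlam : 0 < lam) (hx : 0 < x) (hc : 0 < c) :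
    3 * lam * x / (2 * lam + x) ≤
      3 * lam * c / (2 * lam + c) + 6 * lam ^ 2 / (2 * lam + c) ^ 2 * (x - c) := by
  have h : 3 * lam * c / (2 * lam + c) + 6 * lam ^ 2 / (2 * lam + c) ^ 2 * (x - c)
      - 3 * lam * x / (2 * lam + x)
      = 6 * lam ^ 2 * (x - c) ^ 2 / ((2 * lam + c) ^ 2 * (2 * lam + x)) := by
    field_simp
    ring
  have : 0 ≤ 6 * lam ^ 2 * (x - c) ^ 2 / ((2 * lam + c) ^ 2 * (2 * lam + x)) := by positivity
  linarith

/-- The concave branch of `zstar` is monotone. -/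
theorem concave_branch_mono {lam x y : ℝ} (hlam : 0 < lam) (hx : 0 < x) (hxy : x ≤ y) :
    3 * lam * x / (2 * lam + x) ≤ 3 * lam * y / (2 * lam + y) := by
  rw [div_le_div_iff₀ (by linarith) (by linarith)]
  nlinarith [mul_le_mul_of_nonneg_left hxy (sq_nonneg lam)]

/-- Jensen's bound for resources of value below `λ/2`, together with half the dual value of a
number not exceeding any of theirs. -/
theorem sum_zstar_add_half_le {R : Type*} {lam x : ℝ} (hlam : 0 < lam) {v : R → ℝ}
    {F : Finset R} (hF : F.Nonempty) (hsmall : ∀ r ∈ F, v r < lam / 2) (hx : 0 < x)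
    (hxv : ∀ r ∈ F, x ≤ v r) :
    ∑ r ∈ F, zstar lam (v r) + zstar lam x / 2 ≤
      3 * lam * (∑ r ∈ F, v r) * (F.card + 1 / 2) / (2 * F.card * lam + ∑ r ∈ F, v r) := by
  have hm : (0 : ℝ) < F.card := by exact_mod_cast hF.card_pos
  have hxs : F.card * x ≤ ∑ r ∈ F, v r := by
    simpa using F.card_nsmul_le_sum v x hxv
  set s := ∑ r ∈ F, v r with hs
  set m : ℝ := (F.card : ℝ)
  have hs0 : 0 < s := (mul_pos hm hx).trans_le hxs
  have hc : 0 < s / m := by positivity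
  have hxc : x ≤ s / m := by
    rw [le_div_iff₀ hm]
    linarith
  obtain ⟨a, ha⟩ := hF
  have hxz : zstar lam x ≤ 3 * lam * (s / m) / (2 * lam + s / m) := by
    rw [zstar, if_pos ((hxv a ha).trans_lt (hsmall a ha))]
    exact concave_branch_mono hlam hx hxc
  have hsum : ∑ r ∈ F, zstar lam (v r) ≤ m * (3 * lam * (s / m) / (2 * lam + s / m)) := by
    calc ∑ r ∈ F, zstar lam (v r)
        ≤ ∑ r ∈ F, (3 * lam * (s / m) / (2 * lam + s / m)
            + 6 * lam ^ 2 / (2 * lam + s / m) ^ 2 * (v r - s / m)) := by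
          refine Finset.sum_le_sum fun r hr => ?_
          rw [zstar, if_pos (hsmall r hr)]
          exact concave_branch_le_tangent hlam (hx.trans_le (hxv r hr)) hc
      _ = m * (3 * lam * (s / m) / (2 * lam + s / m)) := by
          rw [Finset.sum_add_distrib, ← Finset.mul_sum, Finset.sum_sub_distrib, ← hs]
          simp only [Finset.sum_const, nsmul_eq_mul]
          change m * _ + _ * (s - m * (s / m)) = _
          rw [mul_div_cancel₀ s hm.ne']
          ring
  have heq : 3 * lam * s * (m + 1 / 2) / (2 * m * lam + s)
      = (m + 1 / 2) * (3 * lam * (s / m) / (2 * lam + s / m)) := by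
    have : 2 * lam + s / m = (2 * m * lam + s) / m := by
      field_simp
    rw [this]
    field_simp
  rw [heq]
  linarith

/-- A resource of value at least `λ/2` and resources of smaller value, of total value at most `λ`
together, meet the bound `3λ/2`. -/
theorem zstar_add_concave_bound_le {lam a s m : ℝ} (ha : lam / 2 ≤ a)
    (hs : 0 < s) (has : a + s ≤ lam) (hm : 1 ≤ m) :
    zstar lam a + 3 * lam * s * (m + 1 / 2) / (2 * m * lam + s) ≤ 3 * lam / 2 := by
  have hlam : 0 < lam := by linarith
  have hden : 0 < 2 * m * lam + s := by positivity
  have h1 : 3 * lam * s * (m + 1 / 2) / (2 * m * lam + s)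
      ≤ 9 / 2 * lam * s / (2 * lam + s) := by
    rw [div_le_div_iff₀ hden (by linarith)]
    have h : 0 ≤ (lam * s) * ((m - 1) * (lam - s)) :=
      mul_nonneg (by positivity) (mul_nonneg (by linarith) (by linarith))
    nlinarith
  have h2 : ∀ t, s ≤ t → 9 / 2 * lam * s / (2 * lam + s) ≤ 9 / 2 * lam * t / (2 * lam + t) := by
    intro t ht
    rw [div_le_div_iff₀ (by linarith) (by linarith)]
    nlinarith [mul_le_mul_of_nonneg_left ht (sq_nonneg lam)]
  rw [zstar, if_neg (not_lt.mpr ha)]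
  split_ifs with h
  · have h3 := h2 (lam - a) (by linarith)
    have hd : 3 * lam - a ≠ 0 := by linarith
    have h4 : 3 * lam * a / (3 * lam - a) + 9 / 2 * lam * (lam - a) / (2 * lam + (lam - a))
        = 3 * lam / 2 := by
      rw [show 2 * lam + (lam - a) = 3 * lam - a by ring]
      field_simp
      ring
    linarith
  · have h3 := h2 (lam / 4) (by linarith)
    have h4 : 9 / 2 * lam * (lam / 4) / (2 * lam + lam / 4) = lam / 2 := by
      field_simp
      ring
    linarith

/-- **Total dual value of a `λ`-minimal thin edge.**  For `λ = 26/99`: if `D`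
is a `λ`-minimal set of thin resources (each of value in `(0, λ)`) and `r₀` is
a resource of least value in `D`, then
`Σ_{r∈D} z*(v r) ≤ 3λ/2 + z*(v r₀)/2`. -/
theorem zstar_edge_bound {R : Type*} [DecidableEq R]
    (lam : ℝ) (hlam : lam = 26 / 99)
    (v : R → ℝ) (D : Finset R)
    (hval : ∀ r ∈ D, 0 < v r ∧ v r < lam)
    (hmin : LamMinimal v lam D)
    (r0 : R) (hr0 : r0 ∈ D) (hleast : ∀ r ∈ D, v r0 ≤ v r) :
    ∑ r ∈ D, zstar lam (v r) ≤ 3 * lam / 2 + zstar lam (v r0) / 2 := by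
  have hl : 0 < lam := by
    rw [hlam]
    norm_num
  have hx := hval r0 hr0
  have hT := hmin.2 _ (Finset.erase_ssubset hr0)
  have hDv := Finset.add_sum_erase D v hr0
  rw [← Finset.add_sum_erase D _ hr0]
  have hsub : ∀ r ∈ D.erase r0, r ∈ D := fun r hr => Finset.mem_of_mem_erase hr
  suffices h : ∑ r ∈ D.erase r0, zstar lam (v r) + zstar lam (v r0) / 2 ≤ 3 * lam / 2 by
    linarith
  have hne : (D.erase r0).Nonempty := by
    rw [Finset.nonempty_iff_ne_empty]
    intro he
    rw [he, Finset.sum_empty] at hDv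
    linarith [hmin.1]
  generalize D.erase r0 = E at *
  by_cases hbig : ∃ a ∈ E, lam / 2 ≤ v a
  · obtain ⟨a, ha, hal⟩ := hbig
    rw [← Finset.add_sum_erase E _ ha] at hT ⊢
    have hsub' : ∀ r ∈ E.erase a, r ∈ D := fun r hr => hsub r (Finset.mem_of_mem_erase hr)
    rcases (E.erase a).eq_empty_or_nonempty with he | hF
    · rw [he, Finset.sum_empty]
      have h1 := zstar_le hx.1 hx.2
      have h2 := zstar_le (hval a (hsub a ha)).1 (hval a (hsub a ha)).2
      linarith
    · have hsmall : ∀ r ∈ E.erase a, v r < lam / 2 := fun r hr => by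
        have := Finset.single_le_sum (fun i hi => (hval i (hsub' i hi)).1.le) hr
        linarith
      have h1 := sum_zstar_add_half_le hl hF hsmall hx.1 fun r hr => hleast r (hsub' r hr)
      have h2 := zstar_add_concave_bound_le hal
        (Finset.sum_pos (fun r hr => (hval r (hsub' r hr)).1) hF) hT.le
        (m := (E.erase a).card) (by exact_mod_cast hF.card_pos)
      linarith
  · push Not at hbig
    refine (sum_zstar_add_half_le hl hne hbig hx.1 fun r hr => hleast r (hsub r hr)).trans ?_
    have hm : (0 : ℝ) < E.card := by exact_mod_cast hne.card_pos
    have hs : 0 < ∑ r ∈ E, v r := Finset.sum_pos (fun r hr => (hval r (hsub r hr)).1) hne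
    rw [div_le_iff₀ (by positivity)]
    nlinarith [mul_le_mul_of_nonneg_left hT.le (mul_pos hl hm).le]
end

section
/- Let λ = 26/99 and let z* be defined by z*(v) = 3λv/(2λ+v) for 0 < v < λ/2, z*(v) = 3λv/(3λ−v) for λ/2 ≤ v < 3λ/4, and z*(v) = λ for 3λ/4 ≤ v < λ. Let (v_i)_{i∈I} be a finite family of reals with 0 < v_i < λ for every i and Σ_{i∈I} v_i > 1 − λ (equivalently, Σ_{i∈I} v_i > (73/26)λ). Then Σ_{i∈I} z*(v_i) ≥ 3λ (equivalently, Σ_{i∈I} z*(v_i) ≥ 1 − (21/26)λ). -/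
theorem zstar_eq_of_ge {lam v : ℝ} (hl : 0 < lam) (h : 3 * lam / 4 ≤ v) : zstar lam v = lam := by
  unfold zstar
  rw [if_neg (by linarith), if_neg (by linarith)]

theorem le_zstar {lam v : ℝ} (h0 : 0 < v) (h1 : v < lam) :
    3 * lam * v / (2 * lam + v) ≤ zstar lam v := by
  have hl : 0 < lam := h0.trans h1
  unfold zstar
  split_ifs with h h'
  · exact le_rfl
  · exact div_le_div_of_nonneg_left (by positivity) (by linarith) (by linarith)
  · rw [div_le_iff₀ (by positivity)]
    nlinarith

theorem mul_le_zstar {lam v : ℝ} (h0 : 0 < v) (h : v < 3 * lam / 4) :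
    6 / 5 * v ≤ zstar lam v := by
  have hl : 0 < lam := by linarith
  unfold zstar
  split_ifs with h'
  · rw [le_div_iff₀ (by positivity)]
    nlinarith
  · rw [le_div_iff₀ (by linarith)]
    nlinarith

/-- The function `v ↦ 3λv/(2λ+v)` is subadditive over finite sums. -/
theorem div_sum_le_sum_zstar {ι : Type*} {lam : ℝ} (hl : 0 < lam) (T : Finset ι) (v : ι → ℝ)
    (hv : ∀ i ∈ T, 0 < v i ∧ v i < lam) :
    3 * lam * (∑ i ∈ T, v i) / (2 * lam + ∑ i ∈ T, v i) ≤ ∑ i ∈ T, zstar lam (v i) := by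
  rw [Finset.mul_sum, Finset.sum_div]
  refine Finset.sum_le_sum fun i hi => le_trans ?_ (le_zstar (hv i hi).1 (hv i hi).2)
  have h0 := (hv i hi).1
  have hle : v i ≤ ∑ j ∈ T, v j :=
    Finset.single_le_sum (f := v) (fun j hj => (hv j hj).1.le) hi
  exact div_le_div_of_nonneg_left (by positivity) (by positivity) (by linarith)

theorem le_zstar_add_div {m r : ℝ} (hm : 8 / 99 ≤ m) (hm' : m < 3 * (26 / 99) / 4)
    (hr : 21 / 99 - m ≤ r) :
    26 / 99 ≤ zstar (26 / 99) m + 3 * (26 / 99) * r / (2 * (26 / 99) + r) := by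
  have hq : 3 * (26 / 99) * (21 / 99 - m) / (2 * (26 / 99) + (21 / 99 - m)) ≤
      3 * (26 / 99) * r / (2 * (26 / 99) + r) := by
    rw [div_le_div_iff₀ (by linarith) (by linarith)]
    nlinarith
  refine le_trans ?_ (add_le_add_right hq _)
  unfold zstar
  split_ifs with h
  · rw [div_add_div _ _ (by linarith) (by linarith), le_div_iff₀ (by nlinarith)]
    nlinarith
  · rw [div_add_div _ _ (by linarith) (by linarith), le_div_iff₀ (by nlinarith)]
    nlinarith

/-- Resources below `3λ/4` of total value more than `1 − 3λ` have total dual value at least `λ`. -/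
theorem le_sum_zstar_of_small {ι : Type*} (S : Finset ι) (v : ι → ℝ)
    (hv : ∀ i ∈ S, 0 < v i ∧ v i < 3 * (26 / 99) / 4) (hsum : 21 / 99 < ∑ i ∈ S, v i) :
    26 / 99 ≤ ∑ i ∈ S, zstar (26 / 99) (v i) := by
  classical
  by_cases hex : ∃ j ∈ S, 8 / 99 ≤ v j
  · obtain ⟨j, hj, hjv⟩ := hex
    rw [← Finset.add_sum_erase S _ hj] at hsum ⊢
    have hrest := div_sum_le_sum_zstar (lam := 26 / 99) (by norm_num) (S.erase j) v
      fun i hi => by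
        have := hv i (Finset.mem_of_mem_erase hi)
        exact ⟨this.1, by linarith⟩
    have := le_zstar_add_div hjv (hv j hj).2
      (show 21 / 99 - v j ≤ ∑ i ∈ S.erase j, v i by linarith)
    linarith
  · push Not at hex
    have : ∑ i ∈ S, 13 / 10 * v i ≤ ∑ i ∈ S, zstar (26 / 99) (v i) := by
      refine Finset.sum_le_sum fun i hi => ?_
      have h0 := (hv i hi).1
      have h1 := hex i hi
      refine le_trans ?_ (le_zstar h0 (by linarith))
      rw [le_div_iff₀ (by positivity)]
      nlinarith
    rw [← Finset.mul_sum] at this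
    linarith

/-- **Lower bound on the dual value of a heavy configuration.**  For
`λ = 26/99`: if `(v i)_{i ∈ I}` is a finite family of reals with
`0 < v i < λ` for every `i` and `Σ_{i∈I} v i > 1 − λ`, then
`Σ_{i∈I} z*(v i) ≥ 3λ`. -/
theorem zstar_config_bound {ι : Type*} (lam : ℝ) (hlam : lam = 26 / 99)
    (I : Finset ι) (v : ι → ℝ)
    (hval : ∀ i ∈ I, 0 < v i ∧ v i < lam)
    (hsum : 1 - lam < ∑ i ∈ I, v i) :
    3 * lam ≤ ∑ i ∈ I, zstar lam (v i) := by
  subst hlam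
  classical
  set B := I.filter fun i => 3 * (26 / 99) / 4 ≤ v i
  set S := I.filter fun i => ¬ 3 * (26 / 99) / 4 ≤ v i
  have hsplit : ∀ f : ι → ℝ, ∑ i ∈ I, f i = ∑ i ∈ B, f i + ∑ i ∈ S, f i := fun f =>
    (Finset.sum_filter_add_sum_filter_not I _ f).symm
  have hSv : ∀ i ∈ S, 0 < v i ∧ v i < 3 * (26 / 99) / 4 := fun i hi => by
    obtain ⟨hiI, hi⟩ := Finset.mem_filter.mp hi
    exact ⟨(hval i hiI).1, not_le.mp hi⟩
  have hBz : ∑ i ∈ B, zstar (26 / 99) (v i) = B.card * (26 / 99) := by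
    rw [← nsmul_eq_mul]
    exact Finset.sum_eq_card_nsmul fun i hi =>
      zstar_eq_of_ge (by norm_num) (Finset.mem_filter.mp hi).2
  have hBv : ∑ i ∈ B, v i ≤ B.card * (26 / 99) := by
    rw [← nsmul_eq_mul]
    exact Finset.sum_le_card_nsmul _ _ _ fun i hi => (hval i (Finset.mem_filter.mp hi).1).2.le
  have hSz : 6 / 5 * ∑ i ∈ S, v i ≤ ∑ i ∈ S, zstar (26 / 99) (v i) := by
    rw [Finset.mul_sum]
    exact Finset.sum_le_sum fun i hi => mul_le_zstar (hSv i hi).1 (hSv i hi).2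
  have hS0 : 0 ≤ ∑ i ∈ S, v i := Finset.sum_nonneg fun i hi => (hSv i hi).1.le
  rw [hsplit] at hsum
  rw [hsplit, hBz]
  obtain hc | hc | hc : B.card ≤ 1 ∨ B.card = 2 ∨ 3 ≤ B.card := by omega
  · have : (B.card : ℝ) ≤ 1 := by exact_mod_cast hc
    linarith
  · rw [hc] at hBv ⊢
    push_cast at hBv ⊢
    have := le_sum_zstar_of_small S v hSv (by linarith)
    linarith
  · have : (3 : ℝ) ≤ B.card := by exact_mod_cast hc
    linarith
end

section
/- Let λ = 26/99 and let z* be defined by z*(v) = 3λv/(2λ+v) for 0 < v < λ/2, z*(v) = 3λv/(3λ−v) for λ/2 ≤ v < 3λ/4, and z*(v) = λ for 3λ/4 ≤ v < λ. Let a, b_1, …, b_k (k ≥ 1) be λ-minimal finite sets of resources whose values satisfy 0 < v_r < λ for every resource r involved, where b_1, …, b_k are pairwise disjoint and each b_j shares at least one resource with a (b_j ∩ a ≠ ∅). Then Σ_{r ∈ a ∪ b_1 ∪ ⋯ ∪ b_k} z*(v_r) ≤ (3λ/2)(k + 1); in particular this sum is at most 3λk. -/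
theorem zstar_nonneg {lam v : ℝ} (hv : 0 < v) (hvl : v < lam) : 0 ≤ zstar lam v := by
  have h3 : 0 < 3 * lam - v := by linarith
  have hl : 0 < lam := hv.trans hvl
  unfold zstar
  split_ifs <;> positivity

theorem zstar_le_s12 {lam v : ℝ} (hv : 0 < v) (hvl : v < lam) : zstar lam v ≤ lam := by
  have hl : 0 < lam := hv.trans hvl
  unfold zstar
  split_ifs with h1 h2
  · rw [div_le_iff₀ (by linarith)]; nlinarith
  · rw [div_le_iff₀ (by linarith)]; nlinarith
  · exact le_rfl

theorem zstar_mono {lam x y : ℝ} (hx : 0 < x) (hxy : x ≤ y) (hy : y < lam) :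
    zstar lam x ≤ zstar lam y := by
  have hl : 0 < lam := by linarith
  have hy0 : 0 < y := hx.trans_le hxy
  by_cases hy2 : y < 3 * lam / 4
  · have hlx : 0 < 2 * lam + x := by linarith
    have hly : 0 < 2 * lam + y := by linarith
    have hlx' : 0 < 3 * lam - x := by linarith
    have hly' : 0 < 3 * lam - y := by linarith
    have hx2 : x < 3 * lam / 4 := by linarith
    unfold zstar
    rw [if_pos hy2, if_pos hx2]
    split_ifs with h1 h2 h2
    · rw [div_le_div_iff₀ hlx hly]
      nlinarith [mul_nonneg (mul_pos hl hl).le (sub_nonneg.2 hxy)]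
    · rw [div_le_div_iff₀ hlx hly']
      have hd : x * (3 * lam - y) ≤ y * (2 * lam + x) := by nlinarith
      nlinarith
    · linarith
    · gcongr
  · refine (zstar_le_s12 hx (hxy.trans_lt hy)).trans (le_of_eq ?_)
    unfold zstar
    rw [if_neg (by linarith), if_neg hy2]

/-- The ratio `zstar lam y / y` is controlled by any smaller value compatible with `y`. -/
theorem zstar_le_of_add_le {lam x y : ℝ} (hx : 0 < x) (hxy : x ≤ y) (hadd : x + y ≤ lam) :
    zstar lam y ≤ 3 * lam * y / (2 * lam + x) := by
  have hy : 0 < y := hx.trans_le hxy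
  have hl : 0 < lam := by linarith
  unfold zstar
  split_ifs with h1 h2
  · gcongr
  · gcongr
    linarith
  · rw [le_div_iff₀ (by linarith)]
    nlinarith

theorem LamMinimal.sum_zstar_le {R : Type*} [DecidableEq R] {lam : ℝ} {v : R → ℝ}
    {D : Finset R} (hl : 0 < lam) (hD : LamMinimal v lam D)
    (hval : ∀ r ∈ D, 0 < v r ∧ v r < lam) {r : R} (hr : r ∈ D) :
    ∑ i ∈ D, zstar lam (v i) ≤ 3 * lam / 2 + zstar lam (v r) / 2 := by
  obtain ⟨m, hm, hmin⟩ := D.exists_min_image v ⟨r, hr⟩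
  have hmono := zstar_mono (hval m hm).1 (hmin r hr) (hval r hr).2
  have hsum := hD.2 _ (Finset.erase_ssubset hm)
  obtain ⟨hm0, hml⟩ := hval m hm
  have hzm := zstar_le_s12 hm0 hml
  rw [← Finset.add_sum_erase D _ hm]
  suffices ∑ i ∈ D.erase m, zstar lam (v i) + zstar lam (v m) / 2 ≤ 3 * lam / 2 by linarith
  obtain hcard | hcard := Nat.lt_or_ge 1 (D.erase m).card
  · have hadd : ∀ i ∈ D.erase m, v m + v i ≤ lam := by
      intro i hi
      obtain ⟨j, hj, hji⟩ := Finset.exists_mem_ne hcard i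
      have hle : v j ≤ ∑ l ∈ (D.erase m).erase i, v l :=
        Finset.single_le_sum (f := v)
          (fun l hl => (hval l (Finset.mem_of_mem_erase (Finset.mem_of_mem_erase hl))).1.le)
          (Finset.mem_erase.2 ⟨hji, hj⟩)
      have hmj := hmin j (Finset.mem_of_mem_erase hj)
      rw [← Finset.add_sum_erase _ _ hi] at hsum
      linarith
    obtain ⟨i, hi⟩ := Finset.card_pos.1 (Nat.zero_lt_one.trans hcard)
    have hmi := hmin i (Finset.mem_of_mem_erase hi)
    have hmadd : v m + v m ≤ lam := by linarith [hadd i hi]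
    have hpos : 0 < 2 * lam + v m := by linarith
    have hE : ∑ i ∈ D.erase m, zstar lam (v i) ≤ 3 * lam * lam / (2 * lam + v m) :=
      calc ∑ i ∈ D.erase m, zstar lam (v i)
          ≤ ∑ i ∈ D.erase m, 3 * lam * v i / (2 * lam + v m) :=
            Finset.sum_le_sum fun i hi => zstar_le_of_add_le hm0
              (hmin i (Finset.mem_of_mem_erase hi)) (hadd i hi)
        _ = 3 * lam * (∑ i ∈ D.erase m, v i) / (2 * lam + v m) := by
            rw [Finset.mul_sum, Finset.sum_div]
        _ ≤ 3 * lam * lam / (2 * lam + v m) := by gcongr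
    have hM := zstar_le_of_add_le hm0 le_rfl hmadd
    have heq : 3 * lam * lam / (2 * lam + v m) + 3 * lam * v m / (2 * lam + v m) / 2
        = 3 * lam / 2 := by
      field_simp
    linarith
  · have hE : ∑ i ∈ D.erase m, zstar lam (v i) ≤ lam := by
      refine (Finset.sum_le_card_nsmul _ _ lam fun i hi => ?_).trans ?_
      · obtain ⟨h0, h1⟩ := hval i (Finset.mem_of_mem_erase hi)
        exact zstar_le_s12 h0 h1
      · have hc : ((D.erase m).card : ℝ) ≤ 1 := by exact_mod_cast hcard
        rw [nsmul_eq_mul]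
        nlinarith
    linarith

/-- **Total dual value of an addable edge together with its blocking edges.**
For `λ = 26/99`: let `a` be the resource set of an addable edge and
`b 1, …, b k` (`k ≥ 1`) the pairwise disjoint resource sets of its blocking
edges, all `λ`-minimal with resource values in `(0, λ)`, each `b j` meeting
`a`.  Then the total dual value of the resources of `a ∪ b 1 ∪ ⋯ ∪ b k` is at
most `(3λ/2)(k+1)`; in particular it is at most `3λk`. -/
theorem zstar_tuple_bound {R : Type*} [Fintype R] [DecidableEq R]
    (lam : ℝ) (hlam : lam = 26 / 99)
    (v : R → ℝ) (k : ℕ) (hk : 1 ≤ k)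
    (a : Finset R) (b : Fin k → Finset R)
    (hval : ∀ r ∈ a ∪ Finset.univ.biUnion b, 0 < v r ∧ v r < lam)
    (hamin : LamMinimal v lam a)
    (hbmin : ∀ j, LamMinimal v lam (b j))
    (hbdisj : ∀ i j : Fin k, i ≠ j → Disjoint (b i) (b j))
    (hblock : ∀ j, b j ∩ a ≠ ∅) :
    ∑ r ∈ a ∪ Finset.univ.biUnion b, zstar lam (v r) ≤ (3 * lam / 2) * (k + 1)
    ∧ ∑ r ∈ a ∪ Finset.univ.biUnion b, zstar lam (v r) ≤ 3 * lam * k := by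
  have hl : 0 < lam := by rw [hlam]; norm_num
  have hbval : ∀ j, ∀ i ∈ b j, 0 < v i ∧ v i < lam := fun j i hi =>
    hval i (Finset.mem_union_right _ (Finset.mem_biUnion.2 ⟨j, Finset.mem_univ j, hi⟩))
  have haval : ∀ i ∈ a, 0 < v i ∧ v i < lam := fun i hi => hval i (Finset.mem_union_left _ hi)
  choose r hr using fun j => Finset.nonempty_iff_ne_empty.2 (hblock j)
  have hrb : ∀ j, r j ∈ b j := fun j => (Finset.mem_inter.1 (hr j)).1
  have hra : ∀ j, r j ∈ a := fun j => (Finset.mem_inter.1 (hr j)).2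
  have hnonneg : ∀ j, 0 ≤ zstar lam (v (r j)) := fun j =>
    zstar_nonneg (haval _ (hra j)).1 (haval _ (hra j)).2
  have hB : ∑ i ∈ Finset.univ.biUnion b, zstar lam (v i)
      ≤ k * (3 * lam / 2) + (∑ j, zstar lam (v (r j))) / 2 := by
    rw [Finset.sum_biUnion fun i _ j _ hij => hbdisj i j hij]
    refine (Finset.sum_le_sum fun j _ => (hbmin j).sum_zstar_le hl (hbval j) (hrb j)).trans ?_
    simp [Finset.sum_add_distrib, Finset.sum_div]
  have hA := hamin.sum_zstar_le hl haval (hra ⟨0, hk⟩)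
  have hr0 : zstar lam (v (r ⟨0, hk⟩)) ≤ ∑ j, zstar lam (v (r j)) :=
    Finset.single_le_sum (f := fun j => zstar lam (v (r j))) (fun j _ => hnonneg j)
      (Finset.mem_univ _)
  have hI : ∑ j, zstar lam (v (r j)) ≤ ∑ i ∈ a ∩ Finset.univ.biUnion b, zstar lam (v i) := by
    rw [Finset.inter_biUnion, Finset.sum_biUnion fun i _ j _ hij =>
      (hbdisj i j hij).mono Finset.inter_subset_right Finset.inter_subset_right]
    refine Finset.sum_le_sum fun j _ => ?_
    refine Finset.single_le_sum (f := fun i => zstar lam (v i)) (fun i hi => ?_)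
      (Finset.mem_inter.2 ⟨hra j, hrb j⟩)
    obtain ⟨h0, h1⟩ := haval i (Finset.mem_inter.1 hi).1
    exact zstar_nonneg h0 h1
  have hU := Finset.sum_union_inter (s₁ := a) (s₂ := Finset.univ.biUnion b)
    (f := fun i => zstar lam (v i))
  have hmain : ∑ i ∈ a ∪ Finset.univ.biUnion b, zstar lam (v i) ≤ (3 * lam / 2) * (k + 1) := by
    linarith
  have hk' : (1 : ℝ) ≤ k := by exact_mod_cast hk
  exact ⟨hmain, hmain.trans (by nlinarith)⟩
end

section
/- Let λ > 0 and let a, b ∈ (0, λ/2) with a + b > λ/2. Set c = a + b − λ/2 and d = λ/2. Then g(c) + h(d) < g(a) + g(b), where g(v) = 3λv/(2λ+v) and h(v) = 3λv/(3λ−v). -/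
/-- **Merging two small values.**  For `g(v) = 3λv/(2λ+v)` and
`h(v) = 3λv/(3λ−v)`: if `a, b ∈ (0, λ/2)` with `a + b > λ/2`, then replacing
`a, b` by `c = a + b − λ/2` and `d = λ/2` strictly decreases the total dual
value: `g(c) + h(d) < g(a) + g(b)`. -/
theorem merge_values_lt (lam : ℝ) (hlam : 0 < lam)
    (a b : ℝ) (ha : 0 < a) (ha' : a < lam / 2) (hb : 0 < b) (hb' : b < lam / 2)
    (hab : lam / 2 < a + b) :
    (3 * lam * (a + b - lam / 2)) / (2 * lam + (a + b - lam / 2))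
      + (3 * lam * (lam / 2)) / (3 * lam - lam / 2)
    < (3 * lam * a) / (2 * lam + a) + (3 * lam * b) / (2 * lam + b) := by
  have hA : 0 < 2 * lam + a := by linarith
  have hB : 0 < 2 * lam + b := by linarith
  have hC : 0 < 2 * lam + (a + b - lam / 2) := by linarith
  have hD : 0 < 5 * lam / 2 := by linarith
  have hg : ∀ v : ℝ, 0 < 2 * lam + v →
      (3 * lam * v) / (2 * lam + v) = 3 * lam - 6 * lam ^ 2 * (1 / (2 * lam + v)) := by
    intro v hv
    rw [mul_one_div, eq_sub_iff_add_eq, ← add_div, div_eq_iff hv.ne']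
    ring
  have hh : (3 * lam * (lam / 2)) / (3 * lam - lam / 2)
      = 3 * lam - 6 * lam ^ 2 * (1 / (5 * lam / 2)) := by
    rw [show 3 * lam - lam / 2 = 5 * lam / 2 by ring]
    field_simp
    ring
  have hprod : (2 * lam + (a + b - lam / 2)) * (5 * lam / 2)
      < (2 * lam + a) * (2 * lam + b) := by
    nlinarith [mul_pos (sub_pos.mpr ha') (sub_pos.mpr hb')]
  have hinv : 1 / (2 * lam + a) + 1 / (2 * lam + b)
      < 1 / (2 * lam + (a + b - lam / 2)) + 1 / (5 * lam / 2) := by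
    rw [div_add_div _ _ hA.ne' hB.ne', div_add_div _ _ hC.ne' hD.ne',
      show 1 * (5 * lam / 2) + (2 * lam + (a + b - lam / 2)) * 1
        = 1 * (2 * lam + b) + (2 * lam + a) * 1 by ring]
    exact div_lt_div_of_pos_left (by linarith) (mul_pos hC hD) hprod
  rw [hg _ hA, hg _ hB, hg _ hC, hh]
  have := mul_lt_mul_of_pos_left hinv (show 0 < 6 * lam ^ 2 by positivity)
  linarith
end

section
/- Let λ > 0 and let a be a real with λ/2 ≤ a < 3λ/4. Then g((21/26)λ − a) + h(a) ≥ λ, with equality when a = λ/2, where g(v) = 3λv/(2λ+v) and h(v) = 3λv/(3λ−v). -/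
/-- **Lower bound on `g((21/26)λ − a) + h(a)`.**  For `λ > 0`,
`g(v) = 3λv/(2λ+v)` and `h(v) = 3λv/(3λ−v)`: for every `a` with
`λ/2 ≤ a < 3λ/4` one has `g((21/26)λ − a) + h(a) ≥ λ`, with equality
when `a = λ/2`. -/
theorem g_add_h_ge (lam : ℝ) (hlam : 0 < lam)
    (a : ℝ) (ha : lam / 2 ≤ a) (ha' : a < 3 * lam / 4) :
    lam ≤ (3 * lam * ((21 / 26) * lam - a)) / (2 * lam + ((21 / 26) * lam - a))
            + (3 * lam * a) / (3 * lam - a)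
    ∧ (a = lam / 2 →
        (3 * lam * ((21 / 26) * lam - a)) / (2 * lam + ((21 / 26) * lam - a))
          + (3 * lam * a) / (3 * lam - a) = lam) := by
  have hD : 0 < 2 * lam + ((21 / 26) * lam - a) := by linarith
  have hE : 0 < 3 * lam - a := by linarith
  constructor
  · rw [div_add_div _ _ hD.ne' hE.ne', le_div_iff₀ (mul_pos hD hE)]
    have h : 0 ≤ lam * ((a - lam / 2) * ((30 / 13) * lam - a)) :=
      mul_nonneg hlam.le (mul_nonneg (by linarith) (by linarith))
    linarith
  · rintro rfl
    rw [div_add_div _ _ hD.ne' hE.ne', div_eq_iff (mul_pos hD hE).ne']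
    ring
end
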